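/- arXiv:1407.3312 — 2 statements merged into one kernel-verified Lean document; each statement's English description precedes it below -/
import Mathlib

section
/- For integers n ≥ 0 and 0 ≤ k ≤ (n choose 2), the number of subsets U ⊆ E(D_n) such that the submonoid generated by U equals E_n and |U| = (n choose 2) + k is equal to w_{nk}, the number of strongly connected, complete digraphs on vertex set {1,...,n} having exactly k double edges. -/
/-- The idempotent `e_{i j}` of the full transformation monoid on `Fin n`, mapping `j` to `i`
and fixing all other points. -/
def eij {n : ℕ} (i j : Fin n) : Function.End (Fin n) :=
  fun x => if x = j then i else x

theorem eij_apply {n : ℕ} (i j x : Fin n) : eij i j x = if x = j then i else x := rfl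

theorem eij_injective_of_ne {n : ℕ} {i j k l : Fin n} (hij : i ≠ j)
    (h : eij i j = eij k l) : i = k ∧ j = l := by
  have h1 := congrFun h j
  have h2 := congrFun h l
  simp only [eij_apply] at h1 h2
  grind

/-- The set of idempotents `e_{i j}` attached to the edges of a relation. -/
def edgeIdempotents {n : ℕ} (R : Fin n → Fin n → Prop) : Set (Function.End (Fin n)) :=
  {f | ∃ i j, R i j ∧ f = eij i j}

theorem eij_mem_edgeIdempotents {n : ℕ} {R : Fin n → Fin n → Prop} {i j : Fin n}
    (hij : i ≠ j) : eij i j ∈ edgeIdempotents R ↔ R i j := by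
  constructor
  · rintro ⟨k, l, hkl, h⟩
    obtain ⟨rfl, rfl⟩ := eij_injective_of_ne hij h
    exact hkl
  · exact fun h => ⟨i, j, h, rfl⟩

theorem edgeIdempotents_injOn {n : ℕ} :
    Set.InjOn (edgeIdempotents (n := n)) {R | ∀ u, ¬ R u u} := by
  intro R hR S hS h
  ext i j
  by_cases hij : i = j
  · subst hij
    exact iff_of_false (hR i) (hS i)
  · rw [← eij_mem_edgeIdempotents (R := R) hij, ← eij_mem_edgeIdempotents (R := S) hij, h]

theorem isIdempotent_eij {n : ℕ} (i j : Fin n) : eij i j * eij i j = eij i j := by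
  funext x
  change eij i j (eij i j x) = eij i j x
  simp only [eij_apply]
  grind

/-- Every idempotent is a product of idempotents `e_{i j}`. -/
theorem idempotent_mem_of_eij_mem {n : ℕ} {M : Submonoid (Function.End (Fin n))}
    (hM : ∀ i j, i ≠ j → eij i j ∈ M) (f : Function.End (Fin n)) (hf : f * f = f) : f ∈ M := by
  classical
  induction hm : (Finset.univ.filter fun x => f x ≠ x).card using Nat.strong_induction_on
    generalizing f with
  | _ m ih =>
    have hff : ∀ x, f (f x) = f x := congrFun hf
    by_cases hid : ∀ x, f x = x
    · have : f = 1 := funext hid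
      rw [this]
      exact M.one_mem
    · push Not at hid
      obtain ⟨x, hx⟩ := hid
      let g : Function.End (Fin n) := fun y => if y = x then x else f y
      have hg : ∀ y, g y = if y = x then x else f y := fun _ => rfl
      have hgM : g ∈ M := by
        refine ih _ ?_ g ?_ rfl
        · rw [← hm]
          apply Finset.card_lt_card
          refine (Finset.ssubset_iff_of_subset ?_).2 ⟨x, by simpa using hx, by simp [hg]⟩
          intro y
          simp only [Finset.mem_filter, Finset.mem_univ, true_and, hg]
          grind
        · funext y
          change g (g y) = g y
          simp only [hg]
          grind
      have hfg : f = eij (f x) x * g := by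
        funext y
        change f y = eij (f x) x (g y)
        simp only [eij_apply, hg]
        grind
      rw [hfg]
      exact M.mul_mem (hM _ _ hx) hgM

/-- Moving the point missed by the image backwards along a path. -/
theorem exists_mem_forall_ne {n : ℕ} {R : Fin n → Fin n → Prop} (hR : ∀ u, ¬ R u u)
    {M : Submonoid (Function.End (Fin n))} (hM : ∀ i j, R i j → eij i j ∈ M)
    {i j p : Fin n} (hij : i ≠ j) (hji : R j i) (hp : Relation.ReflTransGen R i p) :
    ∃ f ∈ M, f i = f j ∧ Set.InjOn f {x | x ≠ j} ∧ ∀ x, f x ≠ p := by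
  induction hp with
  | refl =>
    refine ⟨eij j i, hM _ _ hji, ?_, ?_, ?_⟩
    · simp [eij_apply]
    · intro x hx y hy h
      simp only [eij_apply, Set.mem_ofPred_eq] at *
      grind
    · intro x
      simp only [eij_apply]
      grind
  | @tail p q _ hpq ih =>
    obtain ⟨f, hfM, hfij, hinj, hne⟩ := ih
    have hpq' : p ≠ q := by
      rintro rfl
      exact hR _ hpq
    refine ⟨eij p q * f, M.mul_mem (hM _ _ hpq) hfM, ?_, ?_, ?_⟩
    · exact congrArg (eij p q) hfij
    · intro x hx y hy h
      change eij p q (f x) = eij p q (f y) at h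
      have h1 := hne x
      have h2 := hne y
      apply hinj hx hy
      simp only [eij_apply] at h
      grind
    · intro x
      change eij p q (f x) ≠ q
      simp only [eij_apply]
      grind

theorem eij_mem_of_injOn {n : ℕ} {M : Submonoid (Function.End (Fin n))} {i j : Fin n}
    (hij : i ≠ j) {f : Function.End (Fin n)} (hfM : f ∈ M) (hfij : f i = f j)
    (hinj : Set.InjOn f {x | x ≠ j}) (hne : ∀ x, f x ≠ j) : eij i j ∈ M := by
  let b : {x // x ≠ j} → {x // x ≠ j} := fun x => ⟨f x, hne x⟩
  have hb : Function.Injective b := fun x y h =>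
    Subtype.ext (hinj x.2 y.2 (congrArg Subtype.val h))
  let σ : Equiv.Perm {x // x ≠ j} := Equiv.ofBijective b (Finite.injective_iff_bijective.1 hb)
  have hpow : ∀ (N : ℕ) (x : {x // x ≠ j}), (f ^ N) x = ((σ ^ N) x : Fin n) := by
    intro N
    induction N with
    | zero => intro x; rfl
    | succ N ih =>
      intro x
      rw [pow_succ, pow_succ]
      exact ih (σ x)
  have hfix : ∀ x, x ≠ j → (f ^ orderOf σ) x = x := by
    intro x hx
    rw [hpow _ ⟨x, hx⟩, pow_orderOf_eq_one]
    rfl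
  have heq : eij i j = f ^ orderOf σ := by
    funext x
    by_cases hx : x = j
    · subst hx
      obtain ⟨N, hN⟩ := Nat.exists_eq_succ_of_ne_zero (orderOf_pos σ).ne'
      have h1 : (f ^ orderOf σ) x = (f ^ orderOf σ) i := by
        rw [hN, pow_succ]
        exact congrArg (f ^ N) hfij.symm
      rw [h1, hfix i hij]
      simp [eij_apply]
    · rw [hfix x hx]
      simp [eij_apply, hx]
  rw [heq]
  exact M.pow_mem hfM _

theorem reflTransGen_of_mem_closure {n : ℕ} {R : Fin n → Fin n → Prop}
    {f : Function.End (Fin n)} (hf : f ∈ Submonoid.closure (edgeIdempotents R)) :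
    ∀ x, Relation.ReflTransGen R (f x) x := by
  induction hf using Submonoid.closure_induction with
  | mem f hf =>
    obtain ⟨i, j, hij, rfl⟩ := hf
    intro x
    rw [eij_apply]
    split_ifs with h
    · rw [h]
      exact .single hij
    · exact .refl
  | one => exact fun x => .refl
  | mul f g _ _ ihf ihg => exact fun x => (ihf (g x)).trans (ihg x)

theorem eq_one_or_exists_of_mem_closure {n : ℕ} {R : Fin n → Fin n → Prop}
    {f : Function.End (Fin n)} (hf : f ∈ Submonoid.closure (edgeIdempotents R)) :
    f = 1 ∨ ∃ i j, R i j ∧ f i = f j := by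
  induction hf using Submonoid.closure_induction with
  | mem f hf =>
    obtain ⟨i, j, hij, rfl⟩ := hf
    exact .inr ⟨i, j, hij, by simp [eij_apply]⟩
  | one => exact .inl rfl
  | mul f g _ _ ihf ihg =>
    obtain rfl | ⟨i, j, hij, h⟩ := ihg
    · simpa using ihf
    · exact .inr ⟨i, j, hij, congrArg f h⟩

/-- Howie's criterion: a set of idempotents `e_{i j}` generates the idempotent-generated
submonoid iff the corresponding digraph is complete and strongly connected. -/
theorem closure_edgeIdempotents_eq_iff {n : ℕ} {R : Fin n → Fin n → Prop}
    (hR : ∀ u, ¬ R u u) :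
    Submonoid.closure (edgeIdempotents R)
        = Submonoid.closure {f : Function.End (Fin n) | f * f = f} ↔
      (∀ u v, u ≠ v → R u v ∨ R v u) ∧ ∀ u v, Relation.ReflTransGen R u v := by
  constructor
  · intro h
    have hmem : ∀ i j, eij i j ∈ Submonoid.closure (edgeIdempotents R) := fun i j => by
      rw [h]
      exact Submonoid.subset_closure (isIdempotent_eij i j)
    refine ⟨fun u v huv => ?_, fun u v => ?_⟩
    · obtain h1 | ⟨i, j, hij, h1⟩ := eq_one_or_exists_of_mem_closure (hmem u v)
      · have h2 : eij u v v = v := congrFun h1 v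
        simp only [eij_apply] at h2
        grind
      · simp only [eij_apply] at h1
        have hne : i ≠ j := by
          rintro rfl
          exact hR _ hij
        grind
    · simpa [eij_apply] using reflTransGen_of_mem_closure (hmem u v) v
  · rintro ⟨hc, hs⟩
    have hM : ∀ i j, R i j → eij i j ∈ Submonoid.closure (edgeIdempotents R) :=
      fun i j hij => Submonoid.subset_closure ⟨i, j, hij, rfl⟩
    apply le_antisymm <;> rw [Submonoid.closure_le]
    · rintro _ ⟨i, j, -, rfl⟩
      exact Submonoid.subset_closure (isIdempotent_eij i j)
    · refine idempotent_mem_of_eij_mem fun i j hij => ?_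
      obtain h | h := hc i j hij
      · exact hM i j h
      · obtain ⟨f, hfM, hfij, hinj, hne⟩ := exists_mem_forall_ne hR hM hij h (hs i j)
        exact eij_mem_of_injOn hij hfM hfij hinj hne

theorem ncard_edgeIdempotents {n : ℕ} {R : Fin n → Fin n → Prop} (hR : ∀ u, ¬ R u u) :
    (edgeIdempotents R).ncard = {p : Fin n × Fin n | R p.1 p.2}.ncard := by
  have h : edgeIdempotents R = (fun p => eij p.1 p.2) '' {p : Fin n × Fin n | R p.1 p.2} := by
    ext f
    simp [edgeIdempotents, eq_comm]
  rw [h]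
  apply Set.InjOn.ncard_image
  rintro ⟨i, j⟩ hij ⟨k, l⟩ - h
  have h1 : i ≠ j := by
    rintro rfl
    exact hR _ hij
  obtain ⟨rfl, rfl⟩ := eij_injective_of_ne h1 h
  rfl

/-- In a complete digraph on a linearly ordered vertex set, the number of edges is the number of
pairs `u < v` plus the number of double edges. -/
theorem ncard_edges_eq_ncard_lt_add {α : Type*} [LinearOrder α] [Finite α] {R : α → α → Prop}
    (hR : ∀ u, ¬ R u u) (hc : ∀ u v, u ≠ v → R u v ∨ R v u) :
    {p : α × α | R p.1 p.2}.ncard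
      = {p : α × α | p.1 < p.2}.ncard
        + {p : α × α | p.1 < p.2 ∧ R p.1 p.2 ∧ R p.2 p.1}.ncard := by
  let A : Set (α × α) := {p | p.1 < p.2 ∧ R p.1 p.2}
  let B : Set (α × α) := {p | p.1 < p.2 ∧ R p.2 p.1}
  have hE : {p : α × α | R p.1 p.2} = A ∪ Prod.swap '' B := by
    ext ⟨u, v⟩
    simp only [A, B, Set.mem_ofPred_eq, Set.mem_union, Set.image_swap_eq_preimage_swap,
      Set.mem_preimage, Prod.swap_prod_mk]
    have := hR u
    grind
  have hd : Disjoint A (Prod.swap '' B) := by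
    rw [Set.disjoint_left]
    rintro ⟨u, v⟩ h1 h2
    rw [Set.image_swap_eq_preimage_swap] at h2
    exact lt_asymm h1.1 h2.1
  have hU : {p : α × α | p.1 < p.2} = A ∪ B := by
    ext ⟨u, v⟩
    simp only [A, B, Set.mem_ofPred_eq, Set.mem_union]
    grind
  have hI : {p : α × α | p.1 < p.2 ∧ R p.1 p.2 ∧ R p.2 p.1} = A ∩ B := by
    ext ⟨u, v⟩
    simp only [A, B, Set.mem_ofPred_eq, Set.mem_inter_iff]
    tauto
  rw [hE, hU, hI, Set.ncard_union_add_ncard_inter, Set.ncard_union_eq hd,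
    Set.ncard_image_of_injective _ Prod.swap_injective]

theorem ncard_fin_lt (n : ℕ) : {p : Fin n × Fin n | p.1 < p.2}.ncard = n.choose 2 := by
  have h := ncard_edges_eq_ncard_lt_add (α := Fin n) (R := (· ≠ ·)) (fun u h => h rfl)
    (fun u v h => .inl h)
  have h1 : {p : Fin n × Fin n | p.1 < p.2 ∧ p.1 ≠ p.2 ∧ p.2 ≠ p.1} = {p | p.1 < p.2} := by
    ext p
    simp only [Set.mem_ofPred_eq]
    grind
  have h2 : {p : Fin n × Fin n | p.1 ≠ p.2}
      = ((Finset.univ : Finset (Fin n)).offDiag : Set (Fin n × Fin n)) := by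
    ext p
    simp
  rw [h1, h2, Set.ncard_coe_finset, Finset.offDiag_card, Finset.card_univ, Fintype.card_fin] at h
  rw [Nat.choose_two_right, Nat.mul_sub_one]
  omega

/-- For `0 ≤ k ≤ (n choose 2)`, the number of subsets `U ⊆ E(D_n)` (the
rank-`(n-1)` idempotents `e_{ij}`, `i ≠ j`) with `⟨U⟩ = E_n` and `|U| = (n choose 2) + k`
equals the number `w_{nk}` of strongly connected, complete digraphs on the vertex set
`{1,…,n}` having exactly `k` double edges. -/
theorem stmt_6 (n k : ℕ) (hk : k ≤ n.choose 2) :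
    {U : Set (Function.End (Fin n)) |
        U ⊆ {f : Function.End (Fin n) | ∃ i j : Fin n, i ≠ j ∧ f = eij i j} ∧
        Submonoid.closure U = Submonoid.closure {f : Function.End (Fin n) | f * f = f} ∧
        U.ncard = n.choose 2 + k}.ncard
      = {R : Fin n → Fin n → Prop |
          (∀ u, ¬ R u u) ∧
          (∀ u v, u ≠ v → R u v ∨ R v u) ∧
          (∀ u v, Relation.ReflTransGen R u v) ∧
          {p : Fin n × Fin n | p.1 < p.2 ∧ R p.1 p.2 ∧ R p.2 p.1}.ncard = k}.ncard := by
  have himage : {U : Set (Function.End (Fin n)) |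
        U ⊆ {f : Function.End (Fin n) | ∃ i j : Fin n, i ≠ j ∧ f = eij i j} ∧
        Submonoid.closure U = Submonoid.closure {f : Function.End (Fin n) | f * f = f} ∧
        U.ncard = n.choose 2 + k}
      = edgeIdempotents '' {R : Fin n → Fin n → Prop |
          (∀ u, ¬ R u u) ∧
          (∀ u v, u ≠ v → R u v ∨ R v u) ∧
          (∀ u v, Relation.ReflTransGen R u v) ∧
          {p : Fin n × Fin n | p.1 < p.2 ∧ R p.1 p.2 ∧ R p.2 p.1}.ncard = k} := by
    ext U
    constructor
    · rintro ⟨hU, hcl, hcard⟩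
      let R : Fin n → Fin n → Prop := fun i j => i ≠ j ∧ eij i j ∈ U
      have hR : ∀ u, ¬ R u u := fun u h => h.1 rfl
      have hRU : edgeIdempotents R = U := by
        ext f
        constructor
        · rintro ⟨i, j, hij, rfl⟩
          exact hij.2
        · intro hf
          obtain ⟨i, j, hij, rfl⟩ := hU hf
          exact ⟨i, j, ⟨hij, hf⟩, rfl⟩
      rw [← hRU, closure_edgeIdempotents_eq_iff hR] at hcl
      rw [← hRU, ncard_edgeIdempotents hR, ncard_edges_eq_ncard_lt_add hR hcl.1,
        ncard_fin_lt] at hcard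
      exact ⟨R, ⟨hR, hcl.1, hcl.2, Nat.add_left_cancel hcard⟩, hRU⟩
    · rintro ⟨R, ⟨hR, hc, hs, hcard⟩, rfl⟩
      refine ⟨?_, (closure_edgeIdempotents_eq_iff hR).2 ⟨hc, hs⟩, ?_⟩
      · rintro _ ⟨i, j, hij, rfl⟩
        refine ⟨i, j, ?_, rfl⟩
        rintro rfl
        exact hR _ hij
      · rw [ncard_edgeIdempotents hR, ncard_edges_eq_ncard_lt_add hR hc, ncard_fin_lt, hcard]
  rw [himage]
  exact (edgeIdempotents_injOn.mono fun R hR => hR.1).ncard_image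
end

section
/- For every integer n ≥ 0, every idempotent generating set of E_n contains an idempotent generating set of E_n of minimal cardinality; that is, if U is a set of idempotents of T_n whose generated submonoid is E_n, then U contains a subset V of idempotents with |V| equal to the idempotent rank of E_n (namely 2 if n = 2 and (n choose 2) otherwise) whose generated submonoid is also E_n. -/
section Digraph

variable {α : Type*} [DecidableEq α]

/-- A finite set of arcs without loops, joining any two distinct vertices in at least one
direction, and strongly connected: every proper nonempty set of vertices has an outgoing arc. -/
structure IsStrongSemicomplete (R : Finset (α × α)) : Prop where
  irrefl : ∀ a, (a, a) ∉ R
  total : ∀ a b, a ≠ b → (a, b) ∈ R ∨ (b, a) ∈ R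
  cut : ∀ A : Set α, A.Nonempty → Aᶜ.Nonempty → ∃ a ∈ A, ∃ b ∉ A, (a, b) ∈ R

namespace IsStrongSemicomplete

/-- If an arc of a 2-cycle cannot be deleted, it is the only arc leaving some set. -/
theorem exists_unique_cut {R : Finset (α × α)} (hR : IsStrongSemicomplete R) {u v : α}
    (hvu : (v, u) ∈ R) (hdel : ¬ IsStrongSemicomplete (R.erase (u, v))) :
    ∃ A : Set α, u ∈ A ∧ v ∉ A ∧
      ∀ a ∈ A, ∀ b ∉ A, (a, b) ∈ R → a = u ∧ b = v := by
  have hne : u ≠ v := fun h => hR.irrefl u (by simpa [h] using hvu)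
  by_contra! hcon
  refine hdel ⟨fun a h => hR.irrefl a (Finset.mem_of_mem_erase h), fun a b hab => ?_,
    fun A hA hA' => ?_⟩
  · simp only [Finset.mem_erase, ne_eq, Prod.mk.injEq]
    rcases hR.total a b hab with h | h <;> grind
  · obtain ⟨a, ha, b, hb, hab⟩ := hR.cut A hA hA'
    by_cases h : a = u ∧ b = v
    · obtain ⟨rfl, rfl⟩ := h
      obtain ⟨c, hc, d, hd, hcd, hne'⟩ := hcon A ha hb
      exact ⟨c, hc, d, hd, by simpa [Finset.mem_erase, hcd] using hne'⟩
    · exact ⟨a, ha, b, hb, by simpa [Finset.mem_erase, hab] using h⟩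

/-- On a number of vertices other than two, one of the arcs of any 2-cycle can be deleted. -/
theorem erase_or_erase [Fintype α] (hα : Fintype.card α ≠ 2) {R : Finset (α × α)}
    (hR : IsStrongSemicomplete R) {u v : α} (huv : (u, v) ∈ R) (hvu : (v, u) ∈ R) :
    IsStrongSemicomplete (R.erase (u, v)) ∨ IsStrongSemicomplete (R.erase (v, u)) := by
  by_contra! hcon
  obtain ⟨A, huA, hvA, hA⟩ := hR.exists_unique_cut hvu hcon.1
  obtain ⟨B, hvB, huB, hB⟩ := hR.exists_unique_cut huv hcon.2
  have hne : u ≠ v := fun h => hvA (h ▸ huA)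
  have hinter : ∀ x ∈ A, x ∉ B := by
    intro x hxA hxB
    obtain ⟨a, ⟨haA, haB⟩, b, hb, hab⟩ :=
      hR.cut (A ∩ B) ⟨x, hxA, hxB⟩ ⟨u, fun h => huB h.2⟩
    by_cases hbA : b ∈ A
    · have := hB a haB b (fun h => hb ⟨hbA, h⟩) hab
      exact hvA (this.1 ▸ haA)
    · have := hA a haA b hbA hab
      exact huB (this.1 ▸ haB)
  have hunion : ∀ x ∉ A, x ∈ B := by
    by_contra! hx
    obtain ⟨x, hxA, hxB⟩ := hx
    obtain ⟨a, ha, b, hb, hab⟩ :=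
      hR.cut (A ∪ B) ⟨u, Or.inl huA⟩ ⟨x, fun h => h.elim hxA hxB⟩
    rcases ha with ha | ha
    · exact hb (Or.inr ((hA a ha b (fun h => hb (Or.inl h)) hab).2 ▸ hvB))
    · exact hb (Or.inl ((hB a ha b (fun h => hb (Or.inr h)) hab).2 ▸ huA))
  have hall : ∀ x, x = u ∨ x = v := by
    intro x
    by_cases hx : x ∈ A
    · rcases hR.total x v (fun h => hvA (h ▸ hx)) with h | h
      · exact Or.inl (hA x hx v hvA h).1
      · exact Or.inl (hB v hvB x (hinter x hx) h).2
    · rcases hR.total x u (fun h => hx (h ▸ huA)) with h | h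
      · exact Or.inr (hB x (hunion x hx) u huB h).1
      · exact Or.inr (hA u huA x hx h).2
  apply hα
  rw [← Finset.card_univ, show (Finset.univ : Finset α) = {u, v} by ext x; simpa using hall x,
    Finset.card_pair hne]

/-- A strong semicomplete digraph on other than two vertices has a spanning strong tournament. -/
theorem exists_tournament [Fintype α] (hα : Fintype.card α ≠ 2) (R : Finset (α × α))
    (hR : IsStrongSemicomplete R) :
    ∃ T ⊆ R, IsStrongSemicomplete T ∧ ∀ a b, (a, b) ∈ T → (b, a) ∉ T := by
  induction R using Finset.strongInduction with
  | H R ih =>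
    by_cases h : ∀ a b, (a, b) ∈ R → (b, a) ∉ R
    · exact ⟨R, subset_rfl, hR, h⟩
    · push Not at h
      obtain ⟨u, v, huv, hvu⟩ := h
      rcases hR.erase_or_erase hα huv hvu with h | h
      · obtain ⟨T, hT, hT'⟩ := ih _ (Finset.erase_ssubset huv) h
        exact ⟨T, hT.trans (Finset.erase_subset _ _), hT'⟩
      · obtain ⟨T, hT, hT'⟩ := ih _ (Finset.erase_ssubset hvu) h
        exact ⟨T, hT.trans (Finset.erase_subset _ _), hT'⟩

theorem card_eq_choose [Fintype α] {T : Finset (α × α)} (hT : IsStrongSemicomplete T)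
    (hasymm : ∀ a b, (a, b) ∈ T → (b, a) ∉ T) : T.card = (Fintype.card α).choose 2 := by
  have hunion : (Finset.univ : Finset α).offDiag = T ∪ T.image Prod.swap := by
    ext ⟨a, b⟩
    have h1 := hT.irrefl a
    have h2 := hT.total a b
    simp only [Finset.mem_offDiag, Finset.mem_univ, true_and, Finset.mem_union, Finset.mem_image,
      Prod.exists, Prod.swap_prod_mk, Prod.mk.injEq]
    grind
  have hdisj : Disjoint T (T.image Prod.swap) := by
    rw [Finset.disjoint_left]
    rintro ⟨a, b⟩ hab h
    simp only [Finset.mem_image, Prod.exists, Prod.swap_prod_mk, Prod.mk.injEq] at h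
    grind
  have hcard := congrArg Finset.card hunion
  rw [Finset.card_union_of_disjoint hdisj, Finset.card_image_of_injective _ Prod.swap_injective,
    Finset.offDiag_card, Finset.card_univ] at hcard
  rw [Nat.choose_two_right, Nat.mul_sub_one]
  omega

end IsStrongSemicomplete

end Digraph

section Collapse

theorem End.mul_apply {α : Type*} (f g : Function.End α) (x : α) : (f * g) x = f (g x) := rfl

variable {α : Type*} [DecidableEq α]

/-- The idempotent of defect one sending `i` to `j` and fixing every other point. -/
def collapse (i j : α) : Function.End α := Function.update id i j

theorem collapse_apply (i j x : α) : collapse i j x = if x = i then j else x := by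
  simp [collapse, Function.update_apply]

theorem collapse_mul_self {i j : α} : collapse i j * collapse i j = collapse i j := by
  funext x
  simp only [End.mul_apply, collapse_apply]
  grind

theorem collapse_injOn : Set.InjOn (fun p : α × α => collapse p.1 p.2) {p | p.1 ≠ p.2} := by
  rintro ⟨a, b⟩ hab ⟨c, d⟩ hcd h
  have h1 := congrFun h a
  have h2 := congrFun h c
  simp only [collapse_apply, Set.mem_ofPred_eq] at *
  grind

/-- The arc opposite to an arc of a 3-cycle is generated by the 3-cycle. -/
theorem collapse_eq_sq {a b c : α} (hab : a ≠ b) (hbc : b ≠ c) (hac : a ≠ c) :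
    collapse a c = (collapse a b * collapse b c * collapse c a) *
      (collapse a b * collapse b c * collapse c a) := by
  funext x
  simp only [End.mul_apply, collapse_apply]
  grind

/-- A submonoid containing the collapses along a strong semicomplete digraph contains all of
them. -/
theorem IsStrongSemicomplete.collapse_mem {R : Finset (α × α)} (hR : IsStrongSemicomplete R)
    (M : Submonoid (Function.End α)) (hM : ∀ a b, (a, b) ∈ R → collapse a b ∈ M)
    {i j : α} : collapse i j ∈ M := by
  have htrans : ∀ a b c, a ≠ b → b ≠ c → a ≠ c → collapse a b ∈ M → collapse b c ∈ M →
      collapse a c ∈ M := by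
    intro a b c hab hbc hac h1 h2
    rcases hR.total a c hac with h | h
    · exact hM _ _ h
    · have h3 := hM _ _ h
      have h4 := M.mul_mem (M.mul_mem h1 h2) h3
      rw [collapse_eq_sq hab hbc hac]
      exact M.mul_mem h4 h4
  have hself : ∀ a : α, collapse a a ∈ M := fun a => by
    rw [show collapse a a = (1 : Function.End α) from Function.update_eq_self a id]
    exact M.one_mem
  by_contra hij
  obtain ⟨a, ha, b, hb, hab⟩ := hR.cut {x | collapse i x ∈ M} ⟨i, hself i⟩ ⟨j, hij⟩
  simp only [Set.mem_ofPred_eq] at ha hb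
  have hab' := hM _ _ hab
  have h1 : a ≠ b := fun h => hb (h ▸ ha)
  have h2 : i ≠ b := fun h => hb (h ▸ hself i)
  by_cases h3 : i = a
  · exact hb (h3 ▸ hab')
  · exact hb (htrans i a b h3 h1 h2 ha hab')

/-- A submonoid containing all collapses contains all idempotents. -/
theorem idempotent_mem_of_collapse_mem [Fintype α] (M : Submonoid (Function.End α))
    (hM : ∀ i j, collapse i j ∈ M) (f : Function.End α) (hf : f * f = f) : f ∈ M := by
  obtain ⟨s, hs⟩ : ∃ s : Finset α, ∀ x, f x ≠ x → x ∈ s := ⟨Finset.univ, by simp⟩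
  induction s using Finset.induction_on generalizing f with
  | empty =>
    have : f = 1 := funext fun x => by
      by_contra h
      exact absurd (hs x h) (Finset.notMem_empty x)
    exact this ▸ M.one_mem
  | insert a s _ ih =>
    by_cases ha : f a = a
    · exact ih f hf fun x hx => by
        have := hs x hx
        grind
    · have hff : ∀ x, f (f x) = f x := fun x => congrFun hf x
      have hrange : ∀ x, f x ≠ a := fun x hx => ha (by rw [← hx]; exact hff x)
      let g : Function.End α := Function.update f a a
      have hg : ∀ x, g x = if x = a then a else f x := fun x =>
        Function.update_apply f a a x
      have hgs : g ∈ M := by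
        refine ih g (funext fun x => ?_) fun x hx => ?_
        · simp only [End.mul_apply, hg]
          grind
        · have := hs x
          grind
      have hfg : f = collapse a (f a) * g := by
        funext x
        simp only [End.mul_apply, hg, collapse_apply]
        grind
      rw [hfg]
      exact M.mul_mem (hM _ _) hgs

/-- An element of a closure other than `1` has a nontrivial generator as its last factor. -/
theorem Submonoid.exists_mul_of_mem_closure {M : Type*} [Monoid M] {U : Set M} {f : M}
    (hf : f ∈ Submonoid.closure U) : f = 1 ∨ ∃ u ∈ U, u ≠ 1 ∧ ∃ g, f = g * u := by
  induction hf using Submonoid.closure_induction with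
  | mem x hx =>
    by_cases h : x = 1
    · exact Or.inl h
    · exact Or.inr ⟨x, hx, h, 1, (one_mul x).symm⟩
  | one => exact Or.inl rfl
  | mul x y _ _ hx hy =>
    rcases hy with rfl | ⟨u, hu, hu1, g, rfl⟩
    · simpa using hx
    · exact Or.inr ⟨u, hu, hu1, x * g, (mul_assoc x g u).symm⟩

theorem collapse_mem_or_of_mem_closure {U : Set (Function.End α)} (hU : ∀ f ∈ U, f * f = f)
    {i j : α} (hij : i ≠ j) (h : collapse i j ∈ Submonoid.closure U) :
    collapse i j ∈ U ∨ collapse j i ∈ U := by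
  rcases Submonoid.exists_mul_of_mem_closure h with h | ⟨u, hu, hu1, g, hg⟩
  · have := congrFun h i
    simp only [collapse_apply, if_true] at this
    exact absurd this.symm hij
  · have huu : ∀ x, u (u x) = u x := fun x => congrFun (hU u hu) x
    have hker : ∀ x, collapse i j x = collapse i j (u x) := fun x => by
      rw [hg, End.mul_apply, End.mul_apply, huu]
    simp only [collapse_apply] at hker
    obtain ⟨x, hx⟩ : ∃ x, u x ≠ x := by
      by_contra! hall
      exact hu1 (funext hall)
    have hxx := hker x
    by_cases hxi : x = i
    · left
      rw [show collapse i j = u from funext fun y => ?_]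
      · exact hu
      · have h1 := hker y
        have h2 := huu i
        rw [collapse_apply]
        grind
    · right
      rw [show collapse j i = u from funext fun y => ?_]
      · exact hu
      · have h1 := hker y
        have h2 := huu j
        rw [collapse_apply]
        grind

variable [Fintype α]

/-- An idempotent of defect at most one moving `x` is the collapse of `x` onto its image: the image
of an idempotent misses every moved point. -/
theorem eq_collapse_of_idempotent {u : Function.End α} (hu : u * u = u)
    (hcard : Fintype.card α ≤ (Finset.univ.image u).card + 1) {x : α} (hx : u x ≠ x) :
    u = collapse x (u x) := by
  have huu : ∀ y, u (u y) = u y := fun y => congrFun hu y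
  funext y
  rw [collapse_apply]
  split_ifs with hyx
  · rw [hyx]
  · by_contra hy
    have hsub : Finset.univ.image u ⊆ Finset.univ \ {x, y} := by
      intro z hz
      obtain ⟨w, -, rfl⟩ := Finset.mem_image.1 hz
      have := huu w
      simp only [Finset.mem_sdiff, Finset.mem_univ, true_and, Finset.mem_insert,
        Finset.mem_singleton]
      grind
    have h1 := Finset.card_le_card hsub
    have h2 := Finset.card_sdiff_add_card_eq_card (Finset.subset_univ ({x, y} : Finset α))
    rw [Finset.card_pair (Ne.symm hyx), Finset.card_univ] at h2
    omega

theorem card_le_card_image_collapse {i j : α} :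
    Fintype.card α ≤ (Finset.univ.image (collapse i j)).card + 1 := by
  have hsub : Finset.univ.erase i ⊆ Finset.univ.image (collapse i j) := by
    intro x hx
    refine Finset.mem_image.2 ⟨x, Finset.mem_univ x, ?_⟩
    rw [collapse_apply, if_neg (Finset.ne_of_mem_erase hx)]
  have := Finset.card_le_card hsub
  rw [Finset.card_erase_of_mem (Finset.mem_univ i), Finset.card_univ] at this
  omega

/-- If no collapse in `U` leaves `A`, elements of defect at most one generated by `U`
preserve `A`. -/
theorem mapsTo_of_mem_closure {U : Set (Function.End α)} (hU : ∀ f ∈ U, f * f = f) {A : Set α}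
    (hA : ∀ a ∈ A, ∀ b ∉ A, collapse a b ∉ U) {f : Function.End α}
    (hf : f ∈ Submonoid.closure U)
    (hcard : Fintype.card α ≤ (Finset.univ.image f).card + 1) : Set.MapsTo f A A := by
  induction hf using Submonoid.closure_induction with
  | mem u hu =>
    intro x hx
    by_contra hux
    have hne : u x ≠ x := fun h => hux (h.symm ▸ hx)
    exact hA x hx (u x) hux (eq_collapse_of_idempotent (hU u hu) hcard hne ▸ hu)
  | one => exact Set.mapsTo_id A
  | mul f g _ _ hf hg =>
    have himage : Finset.univ.image (f * g) = (Finset.univ.image g).image f :=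
      Finset.image_image.symm
    have h1 : (Finset.univ.image (f * g)).card ≤ (Finset.univ.image g).card := by
      rw [himage]; exact Finset.card_image_le
    have h2 : (Finset.univ.image (f * g)).card ≤ (Finset.univ.image f).card := by
      rw [himage]; exact Finset.card_le_card (Finset.image_subset_image (Finset.subset_univ _))
    exact (hf (by omega)).comp (hg (by omega))

open scoped Classical in
/-- The collapses in a generating set of idempotents form a strong semicomplete digraph. -/
theorem isStrongSemicomplete_of_closure {U : Set (Function.End α)} (hU : ∀ f ∈ U, f * f = f)
    (hgen : ∀ i j : α, collapse i j ∈ Submonoid.closure U) :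
    IsStrongSemicomplete
      (Finset.univ.filter fun p : α × α => p.1 ≠ p.2 ∧ collapse p.1 p.2 ∈ U) where
  irrefl a := by simp
  total a b hab := by
    simpa [hab, hab.symm] using collapse_mem_or_of_mem_closure hU hab (hgen a b)
  cut A := by
    rintro ⟨i, hi⟩ ⟨j, hj⟩
    by_contra! hcon
    have hA : ∀ a ∈ A, ∀ b ∉ A, collapse a b ∉ U := fun a ha b hb h =>
      hcon a ha b hb (by
        simp only [Finset.mem_filter, Finset.mem_univ, true_and]
        exact ⟨fun hab => hb (hab ▸ ha), h⟩)
    have := mapsTo_of_mem_closure hU hA (hgen i j) card_le_card_image_collapse hi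
    rw [collapse_apply, if_pos rfl] at this
    exact hj this

end Collapse

/-- A strong semicomplete digraph on two vertices consists of both arcs. -/
theorem IsStrongSemicomplete.card_of_two {R : Finset (Fin 2 × Fin 2)}
    (hR : IsStrongSemicomplete R) : R.card = 2 := by
  have harc : ∀ a b : Fin 2, a ≠ b → (a, b) ∈ R := by
    intro a b hab
    obtain ⟨c, hc, d, hd, hcd⟩ := hR.cut {a} ⟨a, rfl⟩ ⟨b, hab.symm⟩
    have hca : c = a := hc
    have hda : d ≠ a := hd
    have hdb : d = b := by omega
    exact hca ▸ hdb ▸ hcd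
  have hR' : R = Finset.univ.offDiag := by
    ext ⟨a, b⟩
    simp only [Finset.mem_offDiag, Finset.mem_univ, true_and]
    exact ⟨fun h hab => hR.irrefl a (by simpa [hab] using h), harc a b⟩
  rw [hR', Finset.offDiag_card]
  simp


/-- For every `n ≥ 0`, every idempotent generating set of
`E_n = {1} ∪ (T_n \ S_n)` (the submonoid of `T_n` generated by the idempotents) contains
an idempotent generating set of minimal cardinality: if `U` is a set of idempotents of
`T_n` generating `E_n` as a monoid, then `U` has a subset `V` of cardinality equal to the
idempotent rank of `E_n` (namely `2` if `n = 2` and `(n choose 2)` otherwise) which also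
generates `E_n`. -/
theorem stmt_8 (n : ℕ) (U : Set (Function.End (Fin n)))
    (hidem : ∀ f ∈ U, f * f = f)
    (hgen : Submonoid.closure U
      = Submonoid.closure {f : Function.End (Fin n) | f * f = f}) :
    ∃ V ⊆ U, V.ncard = (if n = 2 then 2 else n.choose 2) ∧
      Submonoid.closure V
        = Submonoid.closure {f : Function.End (Fin n) | f * f = f} := by
  classical
  have hcol : ∀ i j : Fin n, collapse i j ∈ Submonoid.closure U := fun i j =>
    hgen ▸ Submonoid.subset_closure collapse_mul_self
  have hstrong := isStrongSemicomplete_of_closure hidem hcol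
  obtain ⟨T, hTU, hT, hcard⟩ : ∃ T ⊆ (Finset.univ.filter
      fun p : Fin n × Fin n => p.1 ≠ p.2 ∧ collapse p.1 p.2 ∈ U),
      IsStrongSemicomplete T ∧ T.card = if n = 2 then 2 else n.choose 2 := by
    by_cases hn : n = 2
    · subst hn
      exact ⟨_, subset_rfl, hstrong, hstrong.card_of_two⟩
    · obtain ⟨T, hTU, hT, hasymm⟩ :=
        IsStrongSemicomplete.exists_tournament (by simpa using hn) _ hstrong
      exact ⟨T, hTU, hT, by simpa [hn] using hT.card_eq_choose hasymm⟩
  have hTU' : ∀ p ∈ T, p.1 ≠ p.2 ∧ collapse p.1 p.2 ∈ U := fun p hp =>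
    (Finset.mem_filter.1 (hTU hp)).2
  have hVU : (fun p : Fin n × Fin n => collapse p.1 p.2) '' (T : Set (Fin n × Fin n)) ⊆ U := by
    rintro _ ⟨p, hp, rfl⟩
    exact (hTU' p hp).2
  refine ⟨_, hVU, ?_, le_antisymm (Submonoid.closure_mono (hVU.trans hidem)) ?_⟩
  · rw [Set.InjOn.ncard_image (collapse_injOn.mono fun p hp => (hTU' p hp).1),
      Set.ncard_coe_finset, hcard]
  · exact Submonoid.closure_le.2 fun f hf => idempotent_mem_of_collapse_mem _
      (fun i j => hT.collapse_mem _ fun a b hab =>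
        Submonoid.subset_closure (Set.mem_image_of_mem _ (Finset.mem_coe.2 hab))) f hf
end
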